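/- arXiv:1703.09848 — 2 statements merged into one kernel-verified Lean document; each statement's English description precedes it below -/
import Mathlib

section
/- Let n, r, s be positive integers and let S_r = {(Z₁,…,Zₛ) ∈ (ℝ^{n×n})^s : rank(Z_k) ≤ r for all k, and Σ_{k=1}^s ‖Z_k‖_F² = 1}. Then for every 0 < ε ≤ 1 there exists a finite subset S̄ ⊆ S_r of cardinality at most (3/ε)^{(2n+1)rs} such that for every (Z₁,…,Zₛ) ∈ S_r there exists (Z̄₁,…,Z̄ₛ) ∈ S̄ with √(Σ_{k=1}^s ‖Z_k − Z̄_k‖_F²) ≤ 3ε. -/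
open Matrix MeasureTheory ProbabilityTheory Finset

noncomputable section

/-- Frobenius inner product on square real matrices: `⟨X,Y⟩ = trace (Xᵀ Y)`. -/
def finner {n : ℕ} (X Y : Matrix (Fin n) (Fin n) ℝ) : ℝ := (Xᵀ * Y).trace

/-- Frobenius norm. -/
def fnorm {n : ℕ} (X : Matrix (Fin n) (Fin n) ℝ) : ℝ := Real.sqrt (finner X X)

/-- Euclidean norm on `ℝ^m`. -/
def enorm2 {m : ℕ} (v : Fin m → ℝ) : ℝ := Real.sqrt (∑ p, (v p) ^ 2)

/-- The linear operator `𝒜` associated with measurement matrices `A_p`: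
`(𝒜 Z)_p = (1/√m) ⟨A_p, Z⟩`. -/
def opA {n m : ℕ} (A : Fin m → Matrix (Fin n) (Fin n) ℝ)
    (Z : Matrix (Fin n) (Fin n) ℝ) : Fin m → ℝ :=
  fun p => (1 / Real.sqrt m) * finner (A p) Z

/-- The adjoint operator `𝒜^* v = (1/√m) Σ_p v_p A_p`. -/
def adjA {n m : ℕ} (A : Fin m → Matrix (Fin n) (Fin n) ℝ)
    (v : Fin m → ℝ) : Matrix (Fin n) (Fin n) ℝ :=
  (1 / Real.sqrt m) • ∑ p, v p • A p

/-- Amalgam restricted isometry property at rank `r` with parameter `δ`. -/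
def ARIP {n m s : ℕ} (𝒜 : Fin s → Matrix (Fin n) (Fin n) ℝ → (Fin m → ℝ))
    (r : ℕ) (δ : ℝ) : Prop :=
  ∀ Z : Fin s → Matrix (Fin n) (Fin n) ℝ, (∀ k, (Z k).rank ≤ r) →
    (1 - δ) * ∑ k, fnorm (Z k) ^ 2 ≤ enorm2 (∑ k, 𝒜 k (Z k)) ^ 2 ∧
    enorm2 (∑ k, 𝒜 k (Z k)) ^ 2 ≤ (1 + δ) * ∑ k, fnorm (Z k) ^ 2

/-- Orthogonal projection onto the tangent space determined by the SVD factors `U`, `V`: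
`P_T(G) = UUᵀG + GVVᵀ − UUᵀGVVᵀ`. -/
def Pt {n r : ℕ} (U V : Matrix (Fin n) (Fin r) ℝ)
    (G : Matrix (Fin n) (Fin n) ℝ) : Matrix (Fin n) (Fin n) ℝ :=
  U * Uᵀ * G + G * (V * Vᵀ) - U * Uᵀ * G * (V * Vᵀ)

/-- `X'` is a best rank-`r` approximation of `W` in Frobenius norm. -/
def IsBestRankApprox {n : ℕ} (r : ℕ) (W X' : Matrix (Fin n) (Fin n) ℝ) : Prop :=
  X'.rank ≤ r ∧ ∀ Z : Matrix (Fin n) (Fin n) ℝ, Z.rank ≤ r → fnorm (X' - W) ≤ fnorm (Z - W)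

open Module Metric Function ENNReal in
lemma nrs_card_sep {E : Type*} [NormedAddCommGroup E] [NormedSpace ℝ E] [FiniteDimensional ℝ E]
    (ε : ℝ) (h0 : 0 < ε) (h1 : ε ≤ 1) (s : Finset E) (hs : ∀ c ∈ s, ‖c‖ ≤ 1)
    (h : ∀ c ∈ s, ∀ d ∈ s, c ≠ d → ε ≤ ‖c - d‖) : (s.card : ℝ) ≤ (3 / ε) ^ finrank ℝ E := by
  borelize E
  let μ : Measure E := Measure.addHaar
  let δ : ℝ := ε / 2
  let ρ : ℝ := 3 / 2
  have ρpos : 0 < ρ := by norm_num [ρ]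
  have δpos : 0 < δ := by positivity
  set A := ⋃ c ∈ s, ball (c : E) δ with hA
  have D : Set.Pairwise (s : Set E) (Disjoint on fun c => ball (c : E) δ) := by
    rintro c hc d hd hcd
    apply ball_disjoint_ball
    rw [dist_eq_norm]
    have := h c hc d hd hcd
    simp only [δ]; linarith
  have A_subset : A ⊆ ball (0 : E) ρ := by
    refine Set.iUnion₂_subset fun x hx => ?_
    apply ball_subset_ball'
    have := hs x hx
    rw [dist_zero_right]
    simp only [δ, ρ]; linarith
  have I :
    (s.card : ℝ≥0∞) * ENNReal.ofReal (δ ^ finrank ℝ E) * μ (ball 0 1) ≤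
      ENNReal.ofReal (ρ ^ finrank ℝ E) * μ (ball 0 1) :=
    calc
      (s.card : ℝ≥0∞) * ENNReal.ofReal (δ ^ finrank ℝ E) * μ (ball 0 1) = μ A := by
        rw [hA, measure_biUnion_finset D fun c _ => measurableSet_ball]
        simp only [μ.addHaar_ball_of_pos _ δpos]
        simp only [Finset.sum_const, nsmul_eq_mul, mul_assoc]
      _ ≤ μ (ball (0 : E) ρ) := measure_mono A_subset
      _ = ENNReal.ofReal (ρ ^ finrank ℝ E) * μ (ball 0 1) := by
        simp only [μ.addHaar_ball_of_pos _ ρpos]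
  have J : (s.card : ℝ≥0∞) * ENNReal.ofReal (δ ^ finrank ℝ E) ≤ ENNReal.ofReal (ρ ^ finrank ℝ E) :=
    (ENNReal.mul_le_mul_iff_left (measure_ball_pos _ _ zero_lt_one).ne' measure_ball_lt_top.ne).1 I
  have K := ENNReal.toReal_le_of_le_ofReal (pow_nonneg ρpos.le _) J
  rw [ENNReal.toReal_mul, ENNReal.toReal_ofReal (by positivity), ENNReal.toReal_natCast] at K
  have e : (3 / ε) = ρ / δ := by simp only [ρ, δ]; field_simp
  rw [e, div_pow, le_div_iff₀ (by positivity)]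
  exact K

lemma nrs_net {E : Type*} [NormedAddCommGroup E] [NormedSpace ℝ E] [FiniteDimensional ℝ E]
    (ε : ℝ) (h0 : 0 < ε) (h1 : ε ≤ 1) (A : Set E) (hA : ∀ x ∈ A, ‖x‖ ≤ 1) :
    ∃ t : Finset E, (∀ x ∈ t, x ∈ A) ∧ (t.card : ℝ) ≤ (3 / ε) ^ Module.finrank ℝ E ∧
      ∀ x ∈ A, ∃ y ∈ t, ‖x - y‖ ≤ ε := by
  classical
  let P : ℕ → Prop := fun m => ∃ t : Finset E, (∀ x ∈ t, x ∈ A) ∧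
    (∀ c ∈ t, ∀ d ∈ t, c ≠ d → ε ≤ ‖c - d‖) ∧ t.card = m
  let N := ⌊(3 / ε) ^ Module.finrank ℝ E⌋₊
  have hb : ∀ m, P m → m ≤ N := by
    rintro m ⟨t, ht, hs, rfl⟩
    exact Nat.le_floor (nrs_card_sep ε h0 h1 t (fun c hc => hA c (ht c hc)) hs)
  have hP0 : P 0 := ⟨∅, by simp⟩
  have hg : P (Nat.findGreatest P N) := Nat.findGreatest_spec (m := 0) (Nat.zero_le _) hP0
  obtain ⟨t, ht, hs, hc⟩ := hg
  refine ⟨t, ht, nrs_card_sep ε h0 h1 t (fun c hc => hA c (ht c hc)) hs, fun x hx => ?_⟩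
  by_contra! hcon
  have hxt : x ∉ t := fun hx' => by
    have := hcon x hx'
    simp at this; linarith
  have hP : P (t.card + 1) := by
    refine ⟨insert x t, ?_, ?_, Finset.card_insert_of_notMem hxt⟩
    · intro y hy
      rcases Finset.mem_insert.1 hy with rfl | hy
      · exact hx
      · exact ht y hy
    · intro c hc d hd hcd
      rcases Finset.mem_insert.1 hc with rfl | hc2
      · rcases Finset.mem_insert.1 hd with rfl | hd
        · exact absurd rfl hcd
        · exact (hcon d hd).le
      · rcases Finset.mem_insert.1 hd with rfl | hd
        · rw [norm_sub_rev]; exact (hcon c hc2).le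
        · exact hs c hc2 d hd hcd
  have := Nat.le_findGreatest (hb _ hP) hP
  omega

lemma nrs_isom {A B : Type*} [NormedAddCommGroup A] [InnerProductSpace ℝ A]
    [FiniteDimensional ℝ A] [NormedAddCommGroup B] [InnerProductSpace ℝ B]
    [FiniteDimensional ℝ B] (h : Module.finrank ℝ A ≤ Module.finrank ℝ B) :
    Nonempty (A →ₗᵢ[ℝ] B) := by
  let a := stdOrthonormalBasis ℝ A
  let b := stdOrthonormalBasis ℝ B
  let f : A →ₗ[ℝ] B := a.toBasis.constr ℝ (fun i => b (Fin.castLE h i))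
  refine ⟨f.isometryOfOrthonormal (v := a.toBasis) (by simpa using a.orthonormal) ?_⟩
  have : (⇑f ∘ ⇑a.toBasis) = b ∘ Fin.castLE h := by
    ext i
    simp only [f, Function.comp, Module.Basis.constr_basis]
  rw [this]
  exact b.orthonormal.comp _ (Fin.castLE_injective h)

lemma nrs_factor {n r : ℕ} (hrn : r ≤ n) (S : Submodule ℝ (EuclideanSpace ℝ (Fin n)))
    (hS : Module.finrank ℝ S ≤ r) :
    ∃ Q : EuclideanSpace ℝ (Fin r) →ₗᵢ[ℝ] EuclideanSpace ℝ (Fin n), ∀ x ∈ S, ∃ y, Q y = x := by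
  obtain ⟨L⟩ := nrs_isom (A := S) (B := EuclideanSpace ℝ (Fin r)) (by simpa using hS)
  obtain ⟨J⟩ := nrs_isom (A := EuclideanSpace ℝ (Fin r)) (B := EuclideanSpace ℝ (Fin n))
    (by simpa using hrn)
  let T := (J.comp L).extend
  let T' := T.toLinearIsometryEquiv rfl
  refine ⟨T'.symm.toLinearIsometry.comp J, fun x hx => ⟨L ⟨x, hx⟩, ?_⟩⟩
  have : T x = J (L ⟨x, hx⟩) := (J.comp L).extend_apply ⟨x, hx⟩
  change T'.symm (J (L ⟨x, hx⟩)) = x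
  rw [LinearIsometryEquiv.symm_apply_eq, ← this]
  rfl

lemma nrs_fnorm {n : ℕ} (X : Matrix (Fin n) (Fin n) ℝ) :
    fnorm X ^ 2 = ∑ j, ‖(WithLp.toLp 2 (fun i => X i j) : EuclideanSpace ℝ (Fin n))‖ ^ 2 := by
  have : finner X X = ∑ j, ∑ i, X i j ^ 2 := by
    simp [finner, Matrix.trace, Matrix.mul_apply, sq]
  rw [fnorm, Real.sq_sqrt, this]
  · simp [EuclideanSpace.norm_sq_eq]
  · rw [this]; positivity

/-- columns -/
def nrsF {n r s : ℕ}
    (Q : Fin s → (EuclideanSpace ℝ (Fin r) →L[ℝ] EuclideanSpace ℝ (Fin n)))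
    (R : PiLp 2 (fun _ : Fin s × Fin n => EuclideanSpace ℝ (Fin r))) :
    Fin s → Matrix (Fin n) (Fin n) ℝ := fun k => Matrix.of fun i j => Q k (R (k, j)) i

lemma nrs_rank {n r : ℕ} (Q : EuclideanSpace ℝ (Fin r) →L[ℝ] EuclideanSpace ℝ (Fin n))
    (R : Fin n → EuclideanSpace ℝ (Fin r)) :
    (Matrix.of fun i j => Q (R j) i : Matrix (Fin n) (Fin n) ℝ).rank ≤ r := by
  rw [Matrix.rank_eq_finrank_span_cols]
  let G : EuclideanSpace ℝ (Fin r) →ₗ[ℝ] (Fin n → ℝ) :=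
    (WithLp.linearEquiv 2 ℝ (Fin n → ℝ)).toLinearMap ∘ₗ Q.toLinearMap
  calc _ ≤ Module.finrank ℝ (LinearMap.range G) := by
        apply Submodule.finrank_mono
        rw [Submodule.span_le]
        rintro _ ⟨j, rfl⟩
        exact ⟨R j, rfl⟩
    _ ≤ Module.finrank ℝ (EuclideanSpace ℝ (Fin r)) := LinearMap.finrank_range_le G
    _ = r := by simp

lemma nrs_exists {n r : ℕ} (hrn : r ≤ n) (X : Matrix (Fin n) (Fin n) ℝ) (hX : X.rank ≤ r) :
    ∃ (Q : EuclideanSpace ℝ (Fin r) →ₗᵢ[ℝ] EuclideanSpace ℝ (Fin n))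
      (R : Fin n → EuclideanSpace ℝ (Fin r)), ∀ i j, X i j = Q (R j) i := by
  let e := (WithLp.linearEquiv 2 ℝ (Fin n → ℝ)).symm
  let S := (Submodule.span ℝ (Set.range X.col)).map e.toLinearMap
  have hS : Module.finrank ℝ S ≤ r := by
    refine le_trans (Submodule.finrank_map_le _ _) ?_
    rwa [← Matrix.rank_eq_finrank_span_cols]
  obtain ⟨Q, hQ⟩ := nrs_factor hrn S hS
  have : ∀ j, ∃ y, Q y = e (X.col j) := fun j =>
    hQ _ (Submodule.mem_map_of_mem (Submodule.subset_span ⟨j, rfl⟩))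
  choose R hR using this
  refine ⟨Q, R, fun i j => ?_⟩
  rw [hR]; rfl

lemma nrs_sum {n r s : ℕ}
    (Q : Fin s → (EuclideanSpace ℝ (Fin r) →L[ℝ] EuclideanSpace ℝ (Fin n)))
    (hQ : ∀ k x, ‖Q k x‖ = ‖x‖)
    (R : PiLp 2 (fun _ : Fin s × Fin n => EuclideanSpace ℝ (Fin r))) :
    ∑ k, fnorm (nrsF Q R k) ^ 2 = ‖R‖ ^ 2 := by
  rw [PiLp.norm_sq_eq_of_L2, Fintype.sum_prod_type]
  refine Finset.sum_congr rfl fun k _ => ?_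
  rw [nrs_fnorm]
  refine Finset.sum_congr rfl fun j _ => ?_
  rw [← hQ k (R (k, j))]
  rfl

lemma nrs_main (n r s : ℕ) (hrn : r ≤ n) (ε : ℝ) (h0 : 0 < ε) (h1 : ε ≤ 1) :
    ∃ Sbar : Finset (Fin s → Matrix (Fin n) (Fin n) ℝ),
        (∀ Zb ∈ Sbar, (∀ k, (Zb k).rank ≤ r) ∧ ∑ k, fnorm (Zb k) ^ 2 = 1) ∧
        (Sbar.card : ℝ) ≤ (3 / ε) ^ (2 * n * r * s) ∧
        ∀ Z : Fin s → Matrix (Fin n) (Fin n) ℝ,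
          (∀ k, (Z k).rank ≤ r) → ∑ k, fnorm (Z k) ^ 2 = 1 →
          ∃ Zb ∈ Sbar, Real.sqrt (∑ k, fnorm (Z k - Zb k) ^ 2) ≤ 3 * ε := by
  classical
  obtain ⟨tQ, hQA, hQc, hQn⟩ := nrs_net (E := EuclideanSpace ℝ (Fin r) →L[ℝ] EuclideanSpace ℝ (Fin n))
    ε h0 h1 {Q | ∀ x, ‖Q x‖ = ‖x‖} (fun Q hQ =>
      ContinuousLinearMap.opNorm_le_bound _ zero_le_one (fun x => by rw [hQ x, one_mul]))
  obtain ⟨tR, hRA, hRc, hRn⟩ := nrs_net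
    (E := PiLp 2 (fun _ : Fin s × Fin n => EuclideanSpace ℝ (Fin r)))
    ε h0 h1 {R | ‖R‖ = 1} (fun R hR => le_of_eq hR)
  have dQ : Module.finrank ℝ (EuclideanSpace ℝ (Fin r) →L[ℝ] EuclideanSpace ℝ (Fin n)) = r * n := by
    rw [← (LinearMap.toContinuousLinearMap (𝕜 := ℝ) (E := EuclideanSpace ℝ (Fin r))
      (F' := EuclideanSpace ℝ (Fin n))).finrank_eq, Module.finrank_linearMap]
    simp
  have dR : Module.finrank ℝ (PiLp 2 (fun _ : Fin s × Fin n => EuclideanSpace ℝ (Fin r)))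
      = s * n * r := by
    rw [(WithLp.linearEquiv 2 ℝ (Fin s × Fin n → EuclideanSpace ℝ (Fin r))).finrank_eq,
      Module.finrank_pi_fintype]
    simp
  rw [dQ] at hQc
  rw [dR] at hRc
  have hQ' : ∀ Q ∈ Fintype.piFinset (fun _ : Fin s => tQ), ∀ k x, ‖Q k x‖ = ‖x‖ := by
    intro Q hQ k
    exact hQA _ (Fintype.mem_piFinset.1 hQ k)
  refine ⟨((Fintype.piFinset (fun _ : Fin s => tQ)) ×ˢ tR).image (fun p => nrsF p.1 p.2),
    ?_, ?_, ?_⟩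
  · intro Zb hZ
    obtain ⟨⟨Q, R⟩, hp, rfl⟩ := Finset.mem_image.1 hZ
    rw [Finset.mem_product] at hp
    refine ⟨fun k => nrs_rank _ _, ?_⟩
    rw [nrs_sum Q (hQ' Q hp.1), show ‖R‖ = 1 from hRA R hp.2, one_pow]
  · calc _ ≤ ((((Fintype.piFinset (fun _ : Fin s => tQ)) ×ˢ tR).card : ℕ) : ℝ) := by
          exact_mod_cast Finset.card_image_le
      _ = (tQ.card : ℝ) ^ s * tR.card := by
          rw [Finset.card_product, Fintype.card_piFinset]; simp
      _ ≤ ((3 / ε) ^ (r * n)) ^ s * (3 / ε) ^ (s * n * r) := by gcongr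
      _ = _ := by rw [← pow_mul, ← pow_add]; congr 1; ring
  · intro Z hZ hZ1
    choose Q R hQR using fun k => nrs_exists hrn (Z k) (hZ k)
    let R' : PiLp 2 (fun _ : Fin s × Fin n => EuclideanSpace ℝ (Fin r)) :=
      WithLp.toLp 2 (fun p => R p.1 p.2)
    let Q' := fun k => (Q k).toContinuousLinearMap
    have hF : Z = nrsF Q' R' := by
      funext k
      ext i j
      exact hQR k i j
    have hR' : ‖R'‖ = 1 := by
      rw [hF, nrs_sum Q' (fun k x => (Q k).norm_map x)] at hZ1
      nlinarith [norm_nonneg R']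
    obtain ⟨Rb, hRb, hRd⟩ := hRn R' hR'
    choose Qb hQb hQd using fun k => hQn (Q' k) (fun x => (Q k).norm_map x)
    refine ⟨nrsF Qb Rb, Finset.mem_image.2 ⟨(Qb, Rb), Finset.mem_product.2
      ⟨Fintype.mem_piFinset.2 hQb, hRb⟩, rfl⟩, ?_⟩
    have key : ∑ k, fnorm (Z k - nrsF Qb Rb k) ^ 2 ≤
        2 * ε ^ 2 * ‖R'‖ ^ 2 + 2 * ‖R' - Rb‖ ^ 2 := by
      rw [PiLp.norm_sq_eq_of_L2, PiLp.norm_sq_eq_of_L2, Fintype.sum_prod_type,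
        Fintype.sum_prod_type, Finset.mul_sum, Finset.mul_sum, ← Finset.sum_add_distrib]
      refine Finset.sum_le_sum fun k _ => ?_
      rw [nrs_fnorm, Finset.mul_sum, Finset.mul_sum, ← Finset.sum_add_distrib]
      refine Finset.sum_le_sum fun j _ => ?_
      have e : (WithLp.toLp 2 (fun i => (Z k - nrsF Qb Rb k) i j) : EuclideanSpace ℝ (Fin n))
          = (Q' k - Qb k) (R' (k, j)) + Qb k ((R' - Rb) (k, j)) := by
        rw [hF]
        ext i
        simp [nrsF]
      rw [e]
      have b1 : ‖(Q' k - Qb k) (R' (k, j))‖ ≤ ε * ‖R' (k, j)‖ :=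
        ((Q' k - Qb k).le_opNorm _).trans (by gcongr; exact hQd k)
      have b2 : ‖Qb k ((R' - Rb) (k, j))‖ = ‖(R' - Rb) (k, j)‖ := hQA _ (hQb k) _
      have b3 := norm_add_le ((Q' k - Qb k) (R' (k, j))) (Qb k ((R' - Rb) (k, j)))
      rw [b2] at b3
      set a := ε * ‖R' (k, j)‖ with ha
      set b := ‖(R' - Rb) (k, j)‖
      calc _ ≤ (a + b) ^ 2 := by gcongr; linarith
        _ ≤ 2 * a ^ 2 + 2 * b ^ 2 := by nlinarith [sq_nonneg (a - b)]
        _ = _ := by rw [ha]; ring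
    apply Real.sqrt_le_iff.2 ⟨by positivity, key.trans ?_⟩
    rw [hR']
    have : ‖R' - Rb‖ ^ 2 ≤ ε ^ 2 := by gcongr
    nlinarith [sq_nonneg ε]

/-- An `ε`-net for the set `S_r` of normalized tuples of rank-`≤ r` matrices, of
cardinality at most `(3/ε)^{(2n+1)rs}`. -/
theorem net_for_rank_sphere
    (n r s : ℕ) (hn : 0 < n) (hr : 0 < r) (hs : 0 < s) :
    ∀ ε : ℝ, 0 < ε → ε ≤ 1 →
      ∃ Sbar : Finset (Fin s → Matrix (Fin n) (Fin n) ℝ),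
        (∀ Zb ∈ Sbar, (∀ k, (Zb k).rank ≤ r) ∧ ∑ k, fnorm (Zb k) ^ 2 = 1) ∧
        (Sbar.card : ℝ) ≤ (3 / ε) ^ ((2 * n + 1) * r * s) ∧
        ∀ Z : Fin s → Matrix (Fin n) (Fin n) ℝ,
          (∀ k, (Z k).rank ≤ r) → ∑ k, fnorm (Z k) ^ 2 = 1 →
          ∃ Zb ∈ Sbar, Real.sqrt (∑ k, fnorm (Z k - Zb k) ^ 2) ≤ 3 * ε := by
  intro ε h0 h1
  obtain ⟨S, h2, h3, h4⟩ := nrs_main n (min r n) s (min_le_right _ _) ε h0 h1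
  refine ⟨S, fun Zb hZ => ⟨fun k => ((h2 Zb hZ).1 k).trans (min_le_left _ _), (h2 Zb hZ).2⟩,
    h3.trans ?_, fun Z hZ hZ1 => h4 Z (fun k => le_min (hZ k) ?_) hZ1⟩
  · apply pow_le_pow_right₀
    · rw [le_div_iff₀ h0]; linarith
    · have : min r n ≤ r := min_le_left _ _
      gcongr
      omega
  · simpa using (Z k).rank_le_width
end
end

section
/- Let 𝒜₁,…,𝒜ₛ : ℝ^{n×n} → ℝ^m be linear maps, let 0 < δ < 1, and let S_r = {(Z₁,…,Zₛ) ∈ (ℝ^{n×n})^s : rank(Z_k) ≤ r for all k, Σ_{k=1}^s ‖Z_k‖_F² = 1}. Suppose S̄ ⊆ S_r is such that every element of S_r is within distance δ/(4√2) (in the norm √(Σ_k ‖·‖_F²)) of some element of S̄, and suppose that 1 − δ/2 ≤ ‖Σ_{k=1}^s 𝒜_k(Z̄_k)‖ ≤ 1 + δ/2 for every (Z̄₁,…,Z̄ₛ) ∈ S̄. Then 1 − δ ≤ ‖Σ_{k=1}^s 𝒜_k(Z_k)‖ ≤ 1 + δ for every (Z₁,…,Zₛ) ∈ S_r. -/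
open Matrix MeasureTheory ProbabilityTheory Finset

noncomputable section

lemma net_abstract {E F : Type*} [NormedAddCommGroup E] [NormedSpace ℝ E]
    [NormedAddCommGroup F] [NormedSpace ℝ F] (L : E →L[ℝ] F) (S T : Set E) (δ : ℝ)
    (hδ0 : 0 < δ) (hδ1 : δ < 1)
    (hcone : ∀ z ∈ S, ∀ c : ℝ, c • z ∈ S)
    (hsplit : ∀ z ∈ S, ∀ w ∈ S, ∃ p ∈ S, ∃ q ∈ S, z - w = p + q ∧
      ‖p‖ ^ 2 + ‖q‖ ^ 2 = ‖z - w‖ ^ 2)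
    (hT : ∀ w ∈ T, w ∈ S)
    (hnet : ∀ z ∈ S, ‖z‖ = 1 → ∃ w ∈ T, ‖z - w‖ ≤ δ / (4 * Real.sqrt 2))
    (hb : ∀ w ∈ T, 1 - δ / 2 ≤ ‖L w‖ ∧ ‖L w‖ ≤ 1 + δ / 2) :
    ∀ z ∈ S, ‖z‖ = 1 → 1 - δ ≤ ‖L z‖ ∧ ‖L z‖ ≤ 1 + δ := by
  intro z hz hz1
  set κ := sSup {t : ℝ | ∃ z ∈ S, ‖z‖ = 1 ∧ ‖L z‖ = t} with hκ
  have hbdd : BddAbove {t : ℝ | ∃ z ∈ S, ‖z‖ = 1 ∧ ‖L z‖ = t} := by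
    refine ⟨‖L‖, ?_⟩
    rintro t ⟨z, -, h1, rfl⟩
    simpa [h1] using L.le_opNorm z
  have hle : ∀ z ∈ S, ‖z‖ = 1 → ‖L z‖ ≤ κ := fun z hz h1 => le_csSup hbdd ⟨z, hz, h1, rfl⟩
  have hκ0 : 0 ≤ κ := (norm_nonneg _).trans (hle z hz hz1)
  have hle2 : ∀ p ∈ S, ‖L p‖ ≤ κ * ‖p‖ := by
    intro p hp
    by_cases h0 : p = 0
    · simp [h0]
    have hn : 0 < ‖p‖ := norm_pos_iff.2 h0
    have h := hle (‖p‖⁻¹ • p) (hcone p hp _) (by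
      rw [norm_smul, norm_inv, norm_norm, inv_mul_cancel₀ hn.ne'])
    rw [map_smul, norm_smul, norm_inv, norm_norm, inv_mul_le_iff₀ hn] at h
    linarith
  have hdiff : ∀ z ∈ S, ∀ w ∈ T, ‖z - w‖ ≤ δ / (4 * Real.sqrt 2) → ‖L z - L w‖ ≤ κ * (δ / 4) := by
    intro z hz w hw hd
    obtain ⟨p, hp, q, hq, hpq, hsq⟩ := hsplit z hz w (hT w hw)
    have h1 : ‖L z - L w‖ ≤ κ * ‖p‖ + κ * ‖q‖ := by
      rw [← map_sub, hpq, map_add]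
      exact (norm_add_le _ _).trans (add_le_add (hle2 p hp) (hle2 q hq))
    have h2 : ‖p‖ + ‖q‖ ≤ δ / 4 := by
      have hs : Real.sqrt 2 ^ 2 = 2 := Real.sq_sqrt (by norm_num)
      have h3 : ‖z - w‖ ^ 2 ≤ (δ / (4 * Real.sqrt 2)) ^ 2 :=
        pow_le_pow_left₀ (norm_nonneg _) hd 2
      rw [div_pow, mul_pow, hs] at h3
      apply le_of_sq_le_sq _ (by positivity)
      nlinarith [sq_nonneg (‖p‖ - ‖q‖)]
    calc _ ≤ _ := h1
      _ = κ * (‖p‖ + ‖q‖) := by ring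
      _ ≤ _ := mul_le_mul_of_nonneg_left h2 hκ0
  have hκle : κ ≤ 1 + δ / 2 + κ * (δ / 4) := by
    refine csSup_le (s := {t : ℝ | ∃ z ∈ S, ‖z‖ = 1 ∧ ‖L z‖ = t}) ⟨_, z, hz, hz1, rfl⟩ ?_
    rintro t ⟨z, hz, h1, rfl⟩
    obtain ⟨w, hw, hd⟩ := hnet z hz h1
    have := hdiff z hz w hw hd
    have := norm_sub_norm_le (L z) (L w)
    linarith [(hb w hw).2]
  have hκ1 : κ ≤ 1 + δ := by nlinarith
  refine ⟨?_, (hle z hz hz1).trans hκ1⟩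
  obtain ⟨w, hw, hd⟩ := hnet z hz hz1
  have h1 := hdiff z hz w hw hd
  have h2 := norm_sub_norm_le (L w) (L z)
  rw [norm_sub_rev] at h2
  nlinarith [(hb w hw).1]

lemma exists_proj {n : ℕ} (Z : Matrix (Fin n) (Fin n) ℝ) :
    ∃ P : Matrix (Fin n) (Fin n) ℝ, Pᵀ = P ∧ P * P = P ∧ P * Z = Z ∧ P.rank ≤ Z.rank := by
  let e := Matrix.toEuclideanCLM (n := Fin n) (𝕜 := ℝ)
  let W : Submodule ℝ (EuclideanSpace ℝ (Fin n)) := LinearMap.range (e Z).toLinearMap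
  have hrank : ∀ M : Matrix (Fin n) (Fin n) ℝ,
      M.rank = Module.finrank ℝ (LinearMap.range (e M).toLinearMap) := by
    intro M
    rw [Matrix.rank_eq_finrank_range_toLin M (EuclideanSpace.basisFun (Fin n) ℝ).toBasis
      (EuclideanSpace.basisFun (Fin n) ℝ).toBasis]
    rfl
  refine ⟨e.symm W.starProjection, ?_, ?_, ?_, ?_⟩
  · have h : star W.starProjection = W.starProjection :=
      (isSelfAdjoint_starProjection W)
    rw [← Matrix.conjTranspose_eq_transpose_of_trivial, ← Matrix.star_eq_conjTranspose]
    apply e.injective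
    have h1 : e (star (e.symm W.starProjection)) = star (e (e.symm W.starProjection)) :=
      e.map_star' _
    change e (star (e.symm W.starProjection)) = e (e.symm W.starProjection)
    rw [h1, e.apply_symm_apply, h]
  · rw [← map_mul]
    congr 1
    exact W.isIdempotentElem_starProjection
  · apply e.injective
    have h1 : e (e.symm W.starProjection * Z) = e (e.symm W.starProjection) * e Z :=
      e.map_mul' _ _
    change e (e.symm W.starProjection * Z) = e Z
    rw [h1, e.apply_symm_apply]
    ext1 x
    exact Submodule.starProjection_eq_self_iff.2 ⟨x, rfl⟩
  · rw [hrank, hrank, e.apply_symm_apply]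
    apply le_of_eq
    rw [Submodule.range_starProjection W]

lemma fnorm_sq' {n : ℕ} (X : Matrix (Fin n) (Fin n) ℝ) : fnorm X ^ 2 = ∑ i, ∑ j, X i j ^ 2 := by
  have h : finner X X = ∑ i, ∑ j, X i j ^ 2 := by
    rw [Finset.sum_comm]
    simp [finner, Matrix.trace, Matrix.mul_apply, sq]
  rw [fnorm, h, Real.sq_sqrt (by positivity)]

lemma fnorm_sq_finner {n : ℕ} (X : Matrix (Fin n) (Fin n) ℝ) : fnorm X ^ 2 = finner X X := by
  have h : finner X X = ∑ i, ∑ j, X i j ^ 2 := by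
    rw [Finset.sum_comm]
    simp [finner, Matrix.trace, Matrix.mul_apply, sq]
  rw [fnorm_sq', h]

lemma exists_split {n r : ℕ} (Z W : Matrix (Fin n) (Fin n) ℝ) (hZ : Z.rank ≤ r) (hW : W.rank ≤ r) :
    ∃ P Q : Matrix (Fin n) (Fin n) ℝ, P.rank ≤ r ∧ Q.rank ≤ r ∧ Z - W = P + Q ∧
      fnorm P ^ 2 + fnorm Q ^ 2 = fnorm (Z - W) ^ 2 := by
  obtain ⟨P, hT, hP, hPZ, hr⟩ := exists_proj Z
  refine ⟨P * (Z - W), (P - 1) * W, (Matrix.rank_mul_le_left _ _).trans (hr.trans hZ),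
    (Matrix.rank_mul_le_right _ _).trans hW, ?_, ?_⟩
  · rw [mul_sub, sub_mul, hPZ, one_mul]; abel
  · have hD : Z - W = P * (Z - W) + (P - 1) * W := by
      rw [mul_sub, sub_mul, hPZ, one_mul]; abel
    have h1 : (P * (Z - W))ᵀ * ((P - 1) * W) = 0 := by
      rw [transpose_mul, hT, mul_assoc, ← mul_assoc P, mul_sub P, hP, mul_one, sub_self]
      simp
    have h2 : ((P - 1) * W)ᵀ * (P * (Z - W)) = 0 := by
      have := congrArg transpose h1
      rwa [transpose_mul, transpose_transpose, transpose_zero] at this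
    rw [fnorm_sq_finner, fnorm_sq_finner, fnorm_sq_finner]
    conv_rhs => rw [hD]
    simp only [finner, transpose_add, add_mul, mul_add, h1, h2, trace_add, trace_zero]
    ring

/-- Flattening a tuple of matrices into a Euclidean space. -/
def fromE {n s : ℕ} : EuclideanSpace ℝ (Fin s × Fin n × Fin n) →ₗ[ℝ]
    (Fin s → Matrix (Fin n) (Fin n) ℝ) where
  toFun x := fun k => Matrix.of fun i j => x (k, i, j)
  map_add' x y := by ext; simp
  map_smul' c x := by ext; simp

lemma norm_fromE {n s : ℕ} (x : EuclideanSpace ℝ (Fin s × Fin n × Fin n)) :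
    ‖x‖ ^ 2 = ∑ k, fnorm (fromE x k) ^ 2 := by
  simp [EuclideanSpace.norm_sq_eq, fnorm_sq', Fintype.sum_prod_type, fromE]

lemma fromE_surj {n s : ℕ} (Z : Fin s → Matrix (Fin n) (Fin n) ℝ) :
    ∃ x, fromE x = Z := ⟨WithLp.toLp 2 fun t => Z t.1 t.2.1 t.2.2, by ext; simp [fromE]⟩

/-- From near-isometry on a `δ/(4√2)`-net of `S_r` to near-isometry on all of `S_r`. -/
theorem net_to_full
    {n m s : ℕ} (r : ℕ)
    (𝒜 : Fin s → (Matrix (Fin n) (Fin n) ℝ →ₗ[ℝ] (Fin m → ℝ)))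
    (δ : ℝ) (hδ0 : 0 < δ) (hδ1 : δ < 1)
    (Sbar : Set (Fin s → Matrix (Fin n) (Fin n) ℝ))
    (hSbar : ∀ Zb ∈ Sbar, (∀ k, (Zb k).rank ≤ r) ∧ ∑ k, fnorm (Zb k) ^ 2 = 1)
    (hnet : ∀ Z : Fin s → Matrix (Fin n) (Fin n) ℝ,
      (∀ k, (Z k).rank ≤ r) → ∑ k, fnorm (Z k) ^ 2 = 1 →
      ∃ Zb ∈ Sbar, Real.sqrt (∑ k, fnorm (Z k - Zb k) ^ 2) ≤ δ / (4 * Real.sqrt 2))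
    (hbound : ∀ Zb ∈ Sbar,
      1 - δ / 2 ≤ enorm2 (∑ k, 𝒜 k (Zb k)) ∧ enorm2 (∑ k, 𝒜 k (Zb k)) ≤ 1 + δ / 2) :
    ∀ Z : Fin s → Matrix (Fin n) (Fin n) ℝ,
      (∀ k, (Z k).rank ≤ r) → ∑ k, fnorm (Z k) ^ 2 = 1 →
      1 - δ ≤ enorm2 (∑ k, 𝒜 k (Z k)) ∧ enorm2 (∑ k, 𝒜 k (Z k)) ≤ 1 + δ := by
  classical
  let L0 : EuclideanSpace ℝ (Fin s × Fin n × Fin n) →ₗ[ℝ] EuclideanSpace ℝ (Fin m) :=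
    (WithLp.linearEquiv 2 ℝ (Fin m → ℝ)).symm.toLinearMap ∘ₗ
      (∑ k, 𝒜 k ∘ₗ LinearMap.proj k) ∘ₗ fromE
  let L := LinearMap.toContinuousLinearMap L0
  have hL : ∀ x, ‖L x‖ = enorm2 (∑ k, 𝒜 k (fromE x k)) := by
    intro x
    rw [EuclideanSpace.norm_eq]
    simp [L, L0, enorm2]
  have hn1 : ∀ x : EuclideanSpace ℝ (Fin s × Fin n × Fin n),
      ‖x‖ = 1 ↔ ∑ k, fnorm (fromE x k) ^ 2 = 1 := by
    intro x
    rw [← norm_fromE, pow_eq_one_iff_of_nonneg (norm_nonneg x) two_ne_zero]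
  have key := net_abstract L {x | ∀ k, (fromE x k).rank ≤ r} {x | fromE x ∈ Sbar} δ hδ0 hδ1
    ?_ ?_ ?_ ?_ ?_
  · intro Z hZ hZ1
    obtain ⟨x, rfl⟩ := fromE_surj Z
    have := key x hZ ((hn1 x).2 hZ1)
    rwa [hL] at this
  · intro z hz c k
    have : fromE (c • z) k = fromE z k * (c • 1) := by simp
    rw [this]
    exact (Matrix.rank_mul_le_left _ _).trans (hz k)
  · intro z hz w hw
    choose P Q hP hQ hPQ hsq using fun k => exists_split (fromE z k) (fromE w k) (hz k) (hw k)
    obtain ⟨p, rfl⟩ := fromE_surj P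
    obtain ⟨q, rfl⟩ := fromE_surj Q
    refine ⟨p, hP, q, hQ, ?_, ?_⟩
    · have h : fromE (z - w) = fromE (p + q) := by
        rw [map_sub, map_add]
        funext k
        exact hPQ k
      ext ⟨k, i, j⟩
      exact congrFun (congrFun (congrFun h k) i) j
    · rw [norm_fromE, norm_fromE, norm_fromE, ← Finset.sum_add_distrib]
      refine Finset.sum_congr rfl fun k _ => ?_
      rw [hsq k, map_sub]; rfl
  · intro w hw
    exact (hSbar _ hw).1
  · intro z hz hz1
    obtain ⟨Zb, hZb, hd⟩ := hnet (fromE z) hz ((hn1 z).1 hz1)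
    obtain ⟨w, rfl⟩ := fromE_surj Zb
    refine ⟨w, hZb, ?_⟩
    have h : ‖z - w‖ ^ 2 = ∑ k, fnorm (fromE z k - fromE w k) ^ 2 := by
      rw [norm_fromE, map_sub]; rfl
    rwa [← h, Real.sqrt_sq (norm_nonneg _)] at hd
  · intro w hw
    rw [hL]
    exact hbound _ hw
end
end
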